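/- Let 𝒢 be a closed subgroup of Sym(P) with Aut(P) ⊆ 𝒢, let c₁, …, cₙ ∈ P, and let g : P → P be canonical from (P, c₁, …, cₙ) to P and M-generated by 𝒢. Then either 𝒢 = Sym(P), or for all infinite orbits X, Y of (P, c₁, …, cₙ) with X ÷ Y, the images satisfy g[X] ÷ g[Y]. -/

import Mathlib

variable {P : Type} [PartialOrder P]

/-- `a` and `b` are incomparable elements of the partial order `P`. -/
def Perp (a b : P) : Prop := ¬ a ≤ b ∧ ¬ b ≤ a

/-- `f` is an order-automorphism of `P`. -/
def IsOrderAuto (f : Equiv.Perm P) : Prop := ∀ a b : P, f a ≤ f b ↔ a ≤ b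

/-- `f` is an anti-automorphism of `P`. -/
def IsAntiAuto (f : Equiv.Perm P) : Prop := ∀ a b : P, f a ≤ f b ↔ b ≤ a

/-- Every finite partial order embeds into `P` (universality). -/
def IsUniversal (P : Type) [PartialOrder P] : Prop :=
  ∀ (Q : Type) [PartialOrder Q] [Fintype Q], Nonempty (Q ↪o P)

/-- Every order-isomorphism between two finite subsets of `P` extends to an
order-automorphism of `P` (homogeneity). -/
def IsHomogeneous (P : Type) [PartialOrder P] : Prop :=
  ∀ (S T : Finset P) (e : (S : Set P) ≃o (T : Set P)),
    ∃ g : P ≃o P, ∀ x : (S : Set P), g ↑x = ↑(e x)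

/-- A subgroup of `Sym(P)` is closed iff it contains every permutation that agrees
with one of its members on each finite subset of `P`. -/
def IsClosedSubgroup (G : Subgroup (Equiv.Perm P)) : Prop :=
  ∀ f : Equiv.Perm P,
    (∀ S : Finset P, ∃ g ∈ G, ∀ x ∈ S, (g : Equiv.Perm P) x = f x) → f ∈ G

/-- `h` is an order-automorphism of `P` fixing each of the constants `c i`. -/
def FixingAuto (n : ℕ) (c : Fin n → P) (h : Equiv.Perm P) : Prop :=
  IsOrderAuto h ∧ ∀ i : Fin n, h (c i) = c i

/-- `X` is an orbit of `(P, c₁, …, cₙ)`, i.e. an orbit of the action on `P` of the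
group of automorphisms of `P` fixing each `c i`. -/
def IsOrbit (n : ℕ) (c : Fin n → P) (X : Set P) : Prop :=
  ∃ x : P, X = {y | ∃ h : Equiv.Perm P, FixingAuto n c h ∧ h x = y}

/-- `g` is canonical as a function from `(P, c₁, …, cₙ)` to `P`. -/
def Canonical (n : ℕ) (c : Fin n → P) (g : P → P) : Prop :=
  ∀ (m : ℕ) (a b : Fin m → P),
    (∃ h : Equiv.Perm P, FixingAuto n c h ∧ ∀ j : Fin m, h (a j) = b j) →
    ∃ h' : Equiv.Perm P, IsOrderAuto h' ∧ ∀ j : Fin m, h' (g (a j)) = g (b j)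

/-- `g` is M-generated by the subgroup `G` of `Sym(P)`: on every finite subset of `P`
it agrees with some member of `G`. -/
def MGen (G : Subgroup (Equiv.Perm P)) (g : P → P) : Prop :=
  ∀ S : Finset P, ∃ h ∈ G, ∀ x ∈ S, (h : Equiv.Perm P) x = g x

/-- `g` behaves like `id` on `X`. -/
def BehavesLikeId (g : P → P) (X : Set P) : Prop :=
  ∀ x ∈ X, ∀ x' ∈ X, (x < x' → g x < g x') ∧ (Perp x x' → Perp (g x) (g x'))

/-- `g` behaves like `↕` on `X`. -/
def BehavesLikeRev (g : P → P) (X : Set P) : Prop :=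
  ∀ x ∈ X, ∀ x' ∈ X, (x < x' → g x' < g x) ∧ (Perp x x' → Perp (g x) (g x'))

/-- `g` behaves like `id` between `X` and `Y`. -/
def BehavesLikeIdBetween (g : P → P) (X Y : Set P) : Prop :=
  ∀ x ∈ X, ∀ y ∈ Y,
    (x < y → g x < g y) ∧ (y < x → g y < g x) ∧ (Perp x y → Perp (g x) (g y))

/-- `X ≤ Y` for subsets: some element of `X` lies below some element of `Y`. -/
def SetLE (X Y : Set P) : Prop := ∃ x ∈ X, ∃ y ∈ Y, x ≤ y

/-- `X < Y` for subsets: every element of `X` lies strictly below every element of `Y`. -/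
def SetLT (X Y : Set P) : Prop := ∀ x ∈ X, ∀ y ∈ Y, x < y

/-- The relation `X ÷ Y`. -/
def SetDiv (X Y : Set P) : Prop :=
  (SetLE X Y ∧ ¬ SetLE Y X ∧ ¬ SetLT X Y) ∨ (SetLE Y X ∧ ¬ SetLE X Y ∧ ¬ SetLT Y X)

/-- `f` is a rotation of `P`. -/
def IsRotation (f : Equiv.Perm P) : Prop :=
  ∃ X Y Z : Set P,
    (∀ p : P, p ∈ X ∨ p ∈ Y ∨ p ∈ Z) ∧
    Disjoint X Y ∧ Disjoint X Z ∧ Disjoint Y Z ∧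
    IsLowerSet X ∧ IsUpperSet Z ∧
    (∀ x ∈ X, ∀ z ∈ Z, x < z) ∧
    BehavesLikeId (⇑f) X ∧ BehavesLikeId (⇑f) Y ∧ BehavesLikeId (⇑f) Z ∧
    (∀ x ∈ X, ∀ z ∈ Z, f z < f x) ∧
    (∀ x ∈ X, ∀ y ∈ Y, (f y < f x ↔ Perp x y) ∧ (Perp (f x) (f y) ↔ x < y)) ∧
    (∀ y ∈ Y, ∀ z ∈ Z, (f z < f y ↔ Perp y z) ∧ (Perp (f y) (f z) ↔ y < z))

/-- The ternary relation `Cyc`. -/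
def Cyc (a b c : P) : Prop :=
  (a < b ∧ b < c) ∨ (b < c ∧ c < a) ∨ (c < a ∧ a < b) ∨
  (a < b ∧ Perp c a ∧ Perp c b) ∨ (b < c ∧ Perp a b ∧ Perp a c) ∨
  (c < a ∧ Perp b a ∧ Perp b c)

/-- The ternary relation `Cyc'`, the dual of `Cyc`. -/
def Cyc' (a b c : P) : Prop := Cyc c b a

/-- The ternary relation `Pari`. -/
def Pari (a b c : P) : Prop :=
  (Perp a b ∧ Perp b c ∧ Perp a c) ∨
  (a < b ∧ a < c ∧ Perp b c) ∨ (b < a ∧ b < c ∧ Perp a c) ∨ (c < a ∧ c < b ∧ Perp a b) ∨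
  (b < a ∧ c < a ∧ Perp b c) ∨ (a < b ∧ c < b ∧ Perp a c) ∨ (a < c ∧ b < c ∧ Perp a b)

/-- `f` preserves the ternary relation `R`. -/
def Preserves3 (f : P → P) (R : P → P → P → Prop) : Prop :=
  ∀ a b c : P, R a b c ↔ R (f a) (f b) (f c)

/-- Tuples of the same order type in a homogeneous partial order are conjugate. -/
theorem exists_orderAuto_of_le_iff (hH : IsHomogeneous P) {ι : Type} [Finite ι] (f f' : ι → P)
    (hf : ∀ i j, f i ≤ f j ↔ f' i ≤ f' j) :
    ∃ h : Equiv.Perm P, IsOrderAuto h ∧ ∀ i, h (f i) = f' i := by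
  classical
  have := Fintype.ofFinite ι
  have inj : ∀ i j, f i = f j ↔ f' i = f' j := fun i j => by
    simp only [le_antisymm_iff, hf]
  have memS : ∀ x : ((Finset.univ.image f : Finset P) : Set P), ∃ i, f i = x := fun x => by
    simpa using x.2
  have memT : ∀ x : ((Finset.univ.image f' : Finset P) : Set P), ∃ i, f' i = x := fun x => by
    simpa using x.2
  choose s hs using memS
  choose t ht using memT
  let e : ((Finset.univ.image f : Finset P) : Set P) ≃o
      ((Finset.univ.image f' : Finset P) : Set P) :=
    { toFun := fun x => ⟨f' (s x), by simp⟩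
      invFun := fun x => ⟨f (t x), by simp⟩
      left_inv := fun x => Subtype.ext <| by
        rw [← hs x]
        exact (inj _ _).2 (ht _)
      right_inv := fun x => Subtype.ext <| by
        rw [← ht x]
        exact (inj _ _).1 (hs _)
      map_rel_iff' := fun {x y} => by
        change f' (s x) ≤ f' (s y) ↔ (x : P) ≤ y
        rw [← hf, hs, hs] }
  obtain ⟨h, hh⟩ := hH _ _ e
  refine ⟨h.toEquiv, fun a b => h.le_iff_le, fun i => ?_⟩
  have := hh ⟨f i, by simp⟩
  refine this.trans ?_
  exact (inj _ _).1 (hs _)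

/-- A finite extension of a finite configuration of `P` is realised in `P`. -/
theorem exists_orderEmbedding_extending (hU : IsUniversal P) (hH : IsHomogeneous P)
    {ι Q : Type} [Finite ι] [PartialOrder Q] [Finite Q] (e : ι → Q) (f : ι → P)
    (hef : ∀ i j, e i ≤ e j ↔ f i ≤ f j) : ∃ k : Q ↪o P, ∀ i, k (e i) = f i := by
  have := Fintype.ofFinite Q
  obtain ⟨k⟩ := hU Q
  obtain ⟨h, hh, hk⟩ := exists_orderAuto_of_le_iff hH (fun i => k (e i)) f
    (fun i j => by rw [k.le_iff_le, hef])
  exact ⟨OrderEmbedding.ofMapLEIff (fun q => h (k q)) fun a b => by rw [hh, k.le_iff_le], hk⟩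

theorem FixingAuto.symm {n : ℕ} {c : Fin n → P} {h : Equiv.Perm P} (hh : FixingAuto n c h) :
    FixingAuto n c h.symm := by
  refine ⟨fun a b => ?_, fun i => ?_⟩
  · rw [← hh.1, h.apply_symm_apply, h.apply_symm_apply]
  · rw [h.symm_apply_eq, hh.2]

theorem FixingAuto.mul {n : ℕ} {c : Fin n → P} {h h' : Equiv.Perm P}
    (hh : FixingAuto n c h) (hh' : FixingAuto n c h') : FixingAuto n c (h * h') := by
  refine ⟨fun a b => ?_, fun i => ?_⟩
  · rw [Equiv.Perm.mul_apply, Equiv.Perm.mul_apply, hh.1, hh'.1]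
  · rw [Equiv.Perm.mul_apply, hh'.2, hh.2]

theorem IsOrbit.exists_fixingAuto {n : ℕ} {c : Fin n → P} {X : Set P} (hX : IsOrbit n c X)
    {x y : P} (hx : x ∈ X) (hy : y ∈ X) : ∃ h, FixingAuto n c h ∧ h x = y := by
  obtain ⟨z, rfl⟩ := hX
  obtain ⟨h, hh, rfl⟩ := hx
  obtain ⟨h', hh', rfl⟩ := hy
  exact ⟨h' * h.symm, hh'.mul hh.symm, by simp⟩

theorem IsOrbit.apply_mem {n : ℕ} {c : Fin n → P} {X : Set P} (hX : IsOrbit n c X)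
    {x : P} (hx : x ∈ X) {h : Equiv.Perm P} (hh : FixingAuto n c h) : h x ∈ X := by
  obtain ⟨z, rfl⟩ := hX
  obtain ⟨h', hh', rfl⟩ := hx
  exact ⟨h * h', hh.mul hh', rfl⟩

/-- Elements of an orbit have the same relations to the constants. -/
theorem IsOrbit.le_const_iff {n : ℕ} {c : Fin n → P} {X : Set P} (hX : IsOrbit n c X)
    {x y : P} (hx : x ∈ X) (hy : y ∈ X) (i : Fin n) :
    (x ≤ c i ↔ y ≤ c i) ∧ (c i ≤ x ↔ c i ≤ y) := by
  obtain ⟨h, hh, rfl⟩ := hX.exists_fixingAuto hx hy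
  rw [← hh.1 x, ← hh.1 _ x, hh.2]
  exact ⟨Iff.rfl, Iff.rfl⟩

theorem IsOrbit.ne_const {n : ℕ} {c : Fin n → P} {X : Set P} (hX : IsOrbit n c X)
    (hinf : X.Infinite) {x : P} (hx : x ∈ X) (i : Fin n) : x ≠ c i := by
  rintro rfl
  refine hinf ((Set.finite_singleton (c i)).subset fun y hy => ?_)
  obtain ⟨h, hh, rfl⟩ := hX.exists_fixingAuto hx hy
  exact hh.2 i

theorem IsOrbit.mem_of_const_iff {n : ℕ} {c : Fin n → P} {X : Set P} (hH : IsHomogeneous P)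
    (hX : IsOrbit n c X) {x y : P} (hx : x ∈ X)
    (hle : ∀ i, (x ≤ c i ↔ y ≤ c i) ∧ (c i ≤ x ↔ c i ≤ y)) : y ∈ X := by
  obtain ⟨h, hh, hxy⟩ := exists_orderAuto_of_le_iff hH
    (fun o : Option (Fin n) => o.elim x c) (fun o => o.elim y c)
    (by rintro (_ | i) (_ | j) <;> simp [hle])
  have := hX.apply_mem hx ⟨hh, fun i => hxy (some i)⟩
  rwa [show h x = y from hxy none] at this

/-- The image type of a pair under a canonical function depends only on the orbits of its
entries and on the type of the pair. -/
theorem Canonical.le_iff {n : ℕ} {c : Fin n → P} {g : P → P} (hcan : Canonical n c g)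
    (hH : IsHomogeneous P) {X Y : Set P} (hX : IsOrbit n c X) (hY : IsOrbit n c Y)
    {x x' y y' : P} (hx : x ∈ X) (hx' : x' ∈ X) (hy : y ∈ Y) (hy' : y' ∈ Y)
    (hle : x ≤ y ↔ x' ≤ y') (hge : y ≤ x ↔ y' ≤ x') :
    (g x ≤ g y ↔ g x' ≤ g y') ∧ (g y ≤ g x ↔ g y' ≤ g x') := by
  obtain ⟨h, hh, hxy⟩ := exists_orderAuto_of_le_iff hH
    (fun o : Option (Option (Fin n)) => o.elim x (fun o => o.elim y c))
    (fun o => o.elim x' (fun o => o.elim y' c))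
    (by
      have := hX.le_const_iff hx hx'
      have := hY.le_const_iff hy hy'
      rintro (_ | _ | i) (_ | _ | j) <;> simp [*])
  obtain ⟨h', hh', he⟩ := hcan 2 ![x, y] ![x', y']
    ⟨h, ⟨hh, fun i => hxy (some (some i))⟩, by
      intro j
      fin_cases j
      · exact hxy none
      · exact hxy (some none)⟩
  have e0 : h' (g x) = g x' := he 0
  have e1 : h' (g y) = g y' := he 1
  rw [← hh' (g x), ← hh' (g y), e0, e1]
  exact ⟨Iff.rfl, Iff.rfl⟩

theorem Canonical.perp {n : ℕ} {c : Fin n → P} {g : P → P} (hcan : Canonical n c g)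
    (hH : IsHomogeneous P) (hg : Function.Injective g) {X : Set P} (hX : IsOrbit n c X)
    {x y : P} (hx : x ∈ X) (hy : y ∈ X) (hxy : Perp x y) : Perp (g x) (g y) := by
  have key := (hcan.le_iff hH hX hX hx hy hy hx (iff_of_false hxy.1 hxy.2)
    (iff_of_false hxy.2 hxy.1)).1
  have hne : g x ≠ g y := fun h => hxy.1 (hg h).le
  exact ⟨fun h => hne (le_antisymm h (key.1 h)), fun h => hne (le_antisymm (key.2 h) h)⟩

theorem MGen.injective {α : Type} {G : Subgroup (Equiv.Perm α)} {g : α → α} (hM : MGen G g) :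
    Function.Injective g := by
  classical
  intro x y hxy
  obtain ⟨h, -, hh⟩ := hM {x, y}
  apply h.injective
  rw [hh x (by simp), hh y (by simp), hxy]

/-- If `X ÷ Y` because some element of `X` lies below some element of `Y`, then every finite
partial order with a distinguished upper set embeds into `X ∪ Y` with exactly the upper set
going into `Y`. -/
theorem exists_orderEmbedding_orbits (hU : IsUniversal P) (hH : IsHomogeneous P)
    {n : ℕ} {c : Fin n → P} {X Y : Set P} (hX : IsOrbit n c X) (hY : IsOrbit n c Y)
    (hXi : X.Infinite) (hYi : Y.Infinite)
    (hle : SetLE X Y) (hge : ¬ SetLE Y X) (hlt : ¬ SetLT X Y)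
    {Q : Type} [PartialOrder Q] [Finite Q] (U : Set Q) (hUp : IsUpperSet U) :
    ∃ k : Q ↪o P, (∀ q ∉ U, k q ∈ X) ∧ ∀ q ∈ U, k q ∈ Y := by
  classical
  obtain ⟨x, hx, y, hy, hxy⟩ := hle
  have hyx : ¬ y ≤ x := fun h => hge ⟨y, hy, x, hx, h⟩
  have hxc := hX.ne_const hXi hx
  have hyc := hY.ne_const hYi hy
  have hxcy : ∀ i, ¬ (x ≤ c i ∧ c i ≤ y) := by
    rintro i ⟨h₁, h₂⟩
    refine hlt fun x' hx' y' hy' => ?_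
    have l₁ := ((hX.le_const_iff hx hx' i).1).1 h₁
    have l₂ := ((hY.le_const_iff hy hy' i).2).1 h₂
    exact (lt_of_le_of_ne l₁ (hX.ne_const hXi hx' i)).trans_le l₂
  let w : Q → P := fun q => if q ∈ U then y else x
  have w_mono : ∀ p q, p ≤ q → w p ≤ w q := by
    intro p q hpq
    by_cases hp : p ∈ U
    · simp [w, hp, hUp hpq hp]
    · by_cases hq : q ∈ U <;> simp [w, hp, hq, hxy]
  have w_gap : ∀ p q i, ¬ (w p ≤ c i ∧ c i ≤ w q) := by
    rintro p q i ⟨h₁, h₂⟩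
    by_cases hp : p ∈ U <;> by_cases hq : q ∈ U <;>
      simp only [w, hp, hq, if_true, if_false] at h₁ h₂
    · exact hyc i (le_antisymm h₁ h₂)
    · exact hyx (h₁.trans h₂)
    · exact hxcy i ⟨h₁, h₂⟩
    · exact hxc i (le_antisymm h₁ h₂)
  let le : Set.range c ⊕ Q → Set.range c ⊕ Q → Prop := fun s t => match s, t with
    | .inl a, .inl b => (a : P) ≤ b
    | .inl a, .inr q => (a : P) ≤ w q
    | .inr p, .inl b => w p ≤ b
    | .inr p, .inr q => p ≤ q
  let _ : PartialOrder (Set.range c ⊕ Q) :=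
    { le := le
      lt := fun s t => le s t ∧ ¬ le t s
      le_refl := by rintro (a | p) <;> exact le_refl _
      le_trans := by
        rintro (⟨_, a, rfl⟩ | p) (⟨_, b, rfl⟩ | q) (⟨_, d, rfl⟩ | r) h₁ h₂
        · exact le_trans (show c a ≤ c b from h₁) (show c b ≤ c d from h₂)
        · exact le_trans (show c a ≤ c b from h₁) (show c b ≤ w r from h₂)
        · exact le_trans (show c a ≤ w q from h₁) (show w q ≤ c d from h₂)
        · exact le_trans (show c a ≤ w q from h₁) (w_mono _ _ h₂)
        · exact le_trans (show w p ≤ c b from h₁) (show c b ≤ c d from h₂)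
        · exact (w_gap p r b ⟨h₁, h₂⟩).elim
        · exact le_trans (w_mono _ _ h₁) (show w q ≤ c d from h₂)
        · exact le_trans (show p ≤ q from h₁) h₂
      le_antisymm := by
        rintro (⟨_, a, rfl⟩ | p) (⟨_, b, rfl⟩ | q) h₁ h₂
        · exact congrArg _ (Subtype.ext (le_antisymm (show c a ≤ c b from h₁) h₂))
        · exact (w_gap q q a ⟨h₂, h₁⟩).elim
        · exact (w_gap p p b ⟨h₁, h₂⟩).elim
        · exact congrArg _ (le_antisymm (show p ≤ q from h₁) h₂) }
  obtain ⟨k, hk⟩ := exists_orderEmbedding_extending hU hH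
    (fun i : Fin n => (Sum.inl ⟨c i, Set.mem_range_self i⟩ : Set.range c ⊕ Q)) c (fun i j => Iff.rfl)
  have kle : ∀ s t, k s ≤ k t ↔ le s t := fun s t => k.map_rel_iff'
  have hkw : ∀ q i, (w q ≤ c i ↔ k (.inr q) ≤ c i) ∧ (c i ≤ w q ↔ c i ≤ k (.inr q)) := by
    intro q i
    have h₁ := kle (.inr q) (.inl ⟨c i, Set.mem_range_self i⟩)
    have h₂ := kle (.inl ⟨c i, Set.mem_range_self i⟩) (.inr q)
    rw [hk i] at h₁ h₂
    exact ⟨h₁.symm, h₂.symm⟩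
  refine ⟨OrderEmbedding.ofMapLEIff (fun q => k (.inr q)) fun p q => kle (.inr p) (.inr q),
    fun q hq => ?_, fun q hq => ?_⟩
  · exact hX.mem_of_const_iff hH hx (by simpa [w, hq] using hkw q)
  · exact hY.mem_of_const_iff hH hy (by simpa [w, hq] using hkw q)

/-- If canonical images of pairs in `X × Y` all have the same type, then every finite injective
tuple is mapped to an antichain by some member of the group. -/
theorem exists_mem_map_antichain (hU : IsUniversal P) (hH : IsHomogeneous P)
    {G : Subgroup (Equiv.Perm P)} (hAut : ∀ f : Equiv.Perm P, IsOrderAuto f → f ∈ G)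
    {n : ℕ} {c : Fin n → P} {g : P → P} (hM : MGen G g)
    {X Y : Set P} (hX : IsOrbit n c X) (hY : IsOrbit n c Y)
    (hXi : X.Infinite) (hYi : Y.Infinite)
    (hle : SetLE X Y) (hge : ¬ SetLE Y X) (hlt : ¬ SetLT X Y)
    (hconst : ∀ x ∈ X, ∀ y ∈ Y, ∀ y' ∈ Y, (g x ≤ g y ↔ g x ≤ g y') ∧ (g y ≤ g x ↔ g y' ≤ g x))
    {ι : Type} [Finite ι] (f : ι → P) (hf : Function.Injective f) :
    ∃ h ∈ G, ∀ i j, i ≠ j → ¬ h (f i) ≤ h (f j) := by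
  classical
  have := Fintype.ofFinite ι
  obtain ⟨N, hN⟩ : ∃ N, N = (Finset.univ.filter fun i => ∃ j, j ≠ i ∧
    (f i ≤ f j ∨ f j ≤ f i)).card := ⟨_, rfl⟩
  induction N using Nat.strong_induction_on generalizing f with
  | _ N ih =>
  set D := Finset.univ.filter fun i => ∃ j, j ≠ i ∧ (f i ≤ f j ∨ f j ≤ f i) with hD
  have memD : ∀ i, i ∈ D ↔ ∃ j, j ≠ i ∧ (f i ≤ f j ∨ f j ≤ f i) := by simp [hD]
  rcases D.eq_empty_or_nonempty with hE | hne
  · refine ⟨1, G.one_mem, fun i j hij h => ?_⟩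
    have : i ∈ D := (memD i).2 ⟨j, hij.symm, .inl h⟩
    simp [hE] at this
  obtain ⟨b, hb, hmax⟩ := D.exists_maximalFor f hne
  have bmax : ∀ j, f b ≤ f j → j = b := by
    intro j hj
    by_contra hjb
    exact hjb (hf (le_antisymm (hmax ((memD j).2 ⟨b, Ne.symm hjb, .inr hj⟩) hj) hj))
  let U : Set (Set.range f ⊕ Unit) := {q | Sum.elim (fun p : Set.range f => (p : P) = f b) (fun _ => True) q}
  have hUp : IsUpperSet U := by
    rintro (p | u) (q | v) hpq hp
    · obtain ⟨j, hj⟩ := q.2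
      have hpb : (p : P) = f b := hp
      have hbj : f b ≤ f j := by
        have hpq' : p ≤ q := Sum.inl_le_inl_iff.1 hpq
        rw [hj, ← hpb]
        exact hpq'
      change (q : P) = f b
      rw [← hj, bmax j hbj]
    · simp at hpq
    · simp at hpq
    · trivial
  obtain ⟨k, hkX, hkY⟩ := exists_orderEmbedding_orbits hU hH hX hY hXi hYi hle hge hlt U hUp
  let f₁ : ι → P := fun i => k (.inl ⟨f i, Set.mem_range_self i⟩)
  let f₂ : ι → P := fun i => if i = b then k (.inr ()) else f₁ i
  have hf₁ : ∀ i j, f i ≤ f j ↔ f₁ i ≤ f₁ j := by simp [f₁]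
  have f₁X : ∀ i, i ≠ b → f₁ i ∈ X := fun i hi => hkX _ fun h => hi (hf h)
  have f₁Y : f₁ b ∈ Y := hkY _ rfl
  have yY : k (.inr ()) ∈ Y := hkY _ trivial
  have y_iso : ∀ i, ¬ k (.inr ()) ≤ f₁ i ∧ ¬ f₁ i ≤ k (.inr ()) := by simp [f₁]
  have hf₂ : ∀ i j, g (f₁ i) ≤ g (f₁ j) ↔ g (f₂ i) ≤ g (f₂ j) := by
    intro i j
    by_cases hi : i = b <;> by_cases hj : j = b
    · simp [hi, hj]
    · subst hi
      simpa [f₂, hj] using (hconst _ (f₁X j hj) _ f₁Y _ yY).2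
    · subst hj
      simpa [f₂, hi] using (hconst _ (f₁X i hi) _ f₁Y _ yY).1
    · simp [f₂, hi, hj]
  obtain ⟨h₁, a₁, e₁⟩ := exists_orderAuto_of_le_iff hH f f₁ hf₁
  obtain ⟨h₂, a₂, e₂⟩ := exists_orderAuto_of_le_iff hH (g ∘ f₁) (g ∘ f₂) hf₂
  obtain ⟨h, hG, hg⟩ := hM (Finset.univ.image f₁ ∪ Finset.univ.image f₂)
  have hff₂ : ∀ i, (h⁻¹ * h₂ * h * h₁) (f i) = f₂ i := by
    intro i
    simp only [Equiv.Perm.mul_apply]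
    rw [Equiv.Perm.inv_eq_iff_eq, e₁, hg (f₁ i) (by simp), hg (f₂ i) (by simp)]
    exact e₂ i
  have hmem : h⁻¹ * h₂ * h * h₁ ∈ G :=
    G.mul_mem (G.mul_mem (G.mul_mem (G.inv_mem hG) (hAut _ a₂)) hG) (hAut _ a₁)
  have inj₂ : Function.Injective f₂ := fun i j hij => by
    rw [← hff₂, ← hff₂] at hij
    exact hf ((Equiv.injective _) hij)
  have hcard : (Finset.univ.filter fun i => ∃ j, j ≠ i ∧ (f₂ i ≤ f₂ j ∨ f₂ j ≤ f₂ i)).card < N := by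
    rw [hN]
    refine Finset.card_lt_card ⟨fun i hi => ?_, fun hsub => ?_⟩
    · obtain ⟨j, hji, hij⟩ := by simpa using hi
      refine (memD i).2 ⟨j, hji, ?_⟩
      rw [hf₁, hf₁]
      by_cases hib : i = b
      · have hjb : j ≠ b := fun h => hji (h.trans hib.symm)
        simp [f₂, hib, hjb, y_iso] at hij
      · by_cases hjb : j = b
        · simp [f₂, hib, hjb, y_iso] at hij
        · simpa [f₂, hib, hjb] using hij
    · obtain ⟨j, hjb, hj⟩ := by simpa using hsub hb
      simp [f₂, hjb, y_iso] at hj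
  obtain ⟨h', hG', hh'⟩ := ih _ hcard f₂ inj₂ rfl
  refine ⟨h' * (h⁻¹ * h₂ * h * h₁), G.mul_mem hG' hmem, fun i j hij => ?_⟩
  rw [Equiv.Perm.mul_apply h', Equiv.Perm.mul_apply h', hff₂, hff₂]
  exact hh' i j hij

/-- A closed supergroup of `Aut(P)` which maps every finite tuple to an antichain is `Sym(P)`. -/
theorem eq_top_of_map_antichain (hH : IsHomogeneous P)
    {G : Subgroup (Equiv.Perm P)} (hG : IsClosedSubgroup G)
    (hAut : ∀ f : Equiv.Perm P, IsOrderAuto f → f ∈ G)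
    (hanti : ∀ {ι : Type} [Finite ι] (f : ι → P), Function.Injective f →
      ∃ h ∈ G, ∀ i j, i ≠ j → ¬ h (f i) ≤ h (f j)) : G = ⊤ := by
  refine (Subgroup.eq_top_iff' G).2 fun p => hG p fun S => ?_
  obtain ⟨h₁, hG₁, a₁⟩ := hanti (fun x : S => (x : P)) Subtype.val_injective
  obtain ⟨h₂, hG₂, a₂⟩ := hanti (fun x : S => p x) (p.injective.comp Subtype.val_injective)
  obtain ⟨h, hh, e⟩ := exists_orderAuto_of_le_iff hH (fun x : S => h₁ x) (fun x => h₂ (p x))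
    (fun i j => by
      by_cases hij : i = j
      · simp [hij]
      · exact iff_of_false (a₁ i j hij) (a₂ i j hij))
  refine ⟨h₂⁻¹ * h * h₁, G.mul_mem (G.mul_mem (G.inv_mem hG₂) (hAut _ hh)) hG₁, fun x hx => ?_⟩
  simp only [Equiv.Perm.mul_apply]
  rw [Equiv.Perm.inv_eq_iff_eq]
  exact e ⟨x, hx⟩

theorem SetDiv.symm {X Y : Set P} (h : SetDiv X Y) : SetDiv Y X := Or.symm h

theorem eq_top_or_setDiv_image (hU : IsUniversal P) (hH : IsHomogeneous P)
    {G : Subgroup (Equiv.Perm P)} (hG : IsClosedSubgroup G)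
    (hAut : ∀ f : Equiv.Perm P, IsOrderAuto f → f ∈ G)
    {n : ℕ} {c : Fin n → P} {g : P → P} (hcan : Canonical n c g) (hM : MGen G g)
    {X Y : Set P} (hX : IsOrbit n c X) (hY : IsOrbit n c Y)
    (hXi : X.Infinite) (hYi : Y.Infinite)
    (hle : SetLE X Y) (hge : ¬ SetLE Y X) (hlt : ¬ SetLT X Y) :
    G = ⊤ ∨ SetDiv (g '' X) (g '' Y) := by
  have hg := hM.injective
  obtain ⟨k, hkX, hkY⟩ := exists_orderEmbedding_orbits hU hH hX hY hXi hYi hle hge hlt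
    (Q := Bool ⊕ Unit) {.inl true} (by
      rintro (_ | _) (_ | _) hab ha <;> simp_all [Bool.eq_true_of_true_le])
  obtain ⟨a, ha⟩ : ∃ a, a = k (.inl false) := ⟨_, rfl⟩
  obtain ⟨b, hb⟩ : ∃ b, b = k (.inl true) := ⟨_, rfl⟩
  obtain ⟨a', ha'⟩ : ∃ a', a' = k (.inr ()) := ⟨_, rfl⟩
  have haX : a ∈ X := ha ▸ hkX _ (by simp)
  have haX' : a' ∈ X := ha' ▸ hkX _ (by simp)
  have hbY : b ∈ Y := hb ▸ hkY _ (by simp)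
  have hab : a ≤ b := by simp [ha, hb]
  have hba : ¬ b ≤ a := by simp [ha, hb]
  have hab' : ¬ a' ≤ b := by simp [ha', hb]
  have hba' : ¬ b ≤ a' := by simp [ha', hb]
  have hperp : Perp (g a) (g a') :=
    hcan.perp hH hg hX haX haX' ⟨by simp [ha, ha'], by simp [ha, ha']⟩
  have types : ∀ x ∈ X, ∀ y ∈ Y,
      ((g a ≤ g b ↔ g x ≤ g y) ∧ (g b ≤ g a ↔ g y ≤ g x)) ∨
      ((g a' ≤ g b ↔ g x ≤ g y) ∧ (g b ≤ g a' ↔ g y ≤ g x)) := by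
    intro x hx y hy
    have hyx : ¬ y ≤ x := fun h => hge ⟨y, hy, x, hx, h⟩
    by_cases hxy : x ≤ y
    · exact .inl (hcan.le_iff hH hX hY haX hx hbY hy (iff_of_true hab hxy) (iff_of_false hba hyx))
    · exact .inr (hcan.le_iff hH hX hY haX' hx hbY hy (iff_of_false hab' hxy)
        (iff_of_false hba' hyx))
  by_cases hsame : (g a ≤ g b ↔ g a' ≤ g b) ∧ (g b ≤ g a ↔ g b ≤ g a')
  · left
    refine eq_top_of_map_antichain hH hG hAut fun f hf =>
      exists_mem_map_antichain hU hH hAut hM hX hY hXi hYi hle hge hlt ?_ f hf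
    intro x hx y hy y' hy'
    have h₁ := types x hx y hy
    have h₂ := types x hx y' hy'
    grind
  · right
    have hne : g a ≠ g b := fun h => hba (hg h).ge
    have hne' : g a' ≠ g b := fun h => hba' (hg h).ge
    have n₁ : ¬ (g a ≤ g b ∧ g b ≤ g a') := fun h => hperp.1 (h.1.trans h.2)
    have n₂ : ¬ (g a' ≤ g b ∧ g b ≤ g a) := fun h => hperp.2 (h.1.trans h.2)
    have n₃ : ¬ (g a ≤ g b ∧ g b ≤ g a) := fun h => hne (le_antisymm h.1 h.2)
    have n₄ : ¬ (g a' ≤ g b ∧ g b ≤ g a') := fun h => hne' (le_antisymm h.1 h.2)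
    simp only [SetDiv, SetLE, SetLT, Set.forall_mem_image, Set.exists_mem_image]
    by_cases up : g a ≤ g b ∨ g a' ≤ g b
    · refine .inl ⟨?_, ?_, fun h => ?_⟩
      · rcases up with h | h
        exacts [⟨a, haX, b, hbY, h⟩, ⟨a', haX', b, hbY, h⟩]
      · rintro ⟨y, hy, x, hx, hyx⟩
        have := types x hx y hy
        grind
      · have := (h haX hbY).le
        have := (h haX' hbY).le
        grind
    · refine .inr ⟨?_, ?_, fun h => ?_⟩
      · by_cases h : g b ≤ g a
        · exact ⟨b, hbY, a, haX, h⟩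
        · exact ⟨b, hbY, a', haX', by grind⟩
      · rintro ⟨x, hx, y, hy, hxy⟩
        have := types x hx y hy
        grind
      · have := (h hbY haX).le
        have := (h hbY haX').le
        grind

/-- A canonical function M-generated by `𝒢` preserves the relation `÷` between
infinite orbits, unless `𝒢 = Sym(P)`. -/
theorem canonical_preserves_div [Countable P] [Infinite P]
    (hU : IsUniversal P) (hH : IsHomogeneous P)
    (G : Subgroup (Equiv.Perm P)) (hG : IsClosedSubgroup G)
    (hAut : ∀ f : Equiv.Perm P, IsOrderAuto f → f ∈ G)
    (n : ℕ) (c : Fin n → P) (g : P → P)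
    (hcan : Canonical n c g) (hM : MGen G g) :
    G = ⊤ ∨
      ∀ X Y : Set P, IsOrbit n c X → IsOrbit n c Y →
        X.Infinite → Y.Infinite → SetDiv X Y → SetDiv (g '' X) (g '' Y) := by
  by_cases htop : G = ⊤
  · exact .inl htop
  · refine .inr fun X Y hX hY hXi hYi hXY => ?_
    rcases hXY with ⟨hle, hge, hlt⟩ | ⟨hle, hge, hlt⟩
    · exact (eq_top_or_setDiv_image hU hH hG hAut hcan hM hX hY hXi hYi hle hge hlt).resolve_left
        htop
    · exact ((eq_top_or_setDiv_image hU hH hG hAut hcan hM hY hX hYi hXi hle hge hlt).resolve_left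
        htop).symm
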